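/- The subalgebra of L consisting of the elements fixed by both φ₁ and φ₂ is an abelian Lie subalgebra of dimension 6; the subalgebra of elements fixed by both φ₁ and φ₃ is likewise an abelian Lie subalgebra of dimension 6; and the intersection of these two subalgebras is 0. -/

import Mathlib

noncomputable section

open Matrix
open scoped BigOperators

variable (F : Type*) [Field F] [IsAlgClosed F] [CharZero F]

set_option linter.unusedSectionVars false

/-- `gl₃ = M₃(F)`, the matrix algebra of a 3-dimensional space in a fixed basis. -/
abbrev gl3 := Matrix (Fin 3) (Fin 3) F

/-- Coordinates of a tensor in `X₁ ⊗ X₂ ⊗ X₃` with respect to the fixed bases. -/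
abbrev T3 := Fin 3 → Fin 3 → Fin 3 → F

/-- The ambient space `(gl₃)³ × (X₁⊗X₂⊗X₃) × (X₁*⊗X₂*⊗X₃*)` containing the model of e₆. -/
abbrev Mbig := (gl3 F × gl3 F × gl3 F) × (T3 F × T3 F)

/-- Trace-zero matrices: the coordinate model of `sl(X_i)`. -/
def sl3 : Submodule F (gl3 F) where
  carrier := {g | Matrix.trace g = 0}
  add_mem' := by intro a b ha hb; simp_all [Matrix.trace_add]
  zero_mem' := by simp
  smul_mem' := by intro c a ha; simp_all [Matrix.trace_smul]

lemma mem_sl3 {g : gl3 F} : g ∈ sl3 F ↔ Matrix.trace g = 0 := Iff.rfl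

/-- The model of `e₆`: `sl(X₁)⊕sl(X₂)⊕sl(X₃) ⊕ X₁⊗X₂⊗X₃ ⊕ X₁*⊗X₂*⊗X₃*`, as a submodule
of the ambient space. -/
def Lsub : Submodule F (Mbig F) :=
  ((sl3 F).prod ((sl3 F).prod (sl3 F))).prod
    ((⊤ : Submodule F (T3 F)).prod (⊤ : Submodule F (T3 F)))

/-- The fixed alternating trilinear form: determinant of the matrix with rows `x, y, z`. -/
def det3 (x y z : Fin 3 → F) : F := Matrix.det (Matrix.of ![x, y, z])

/-- The Levi-Civita symbol `ε_{abc} = det(e_a, e_b, e_c)`, encoding the identification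
`X∧X ≅ X*` given by `x∧y ↦ det(x,y,−)` (and dually `X*∧X* ≅ X`). -/
def eps (a b c : Fin 3) : F :=
  det3 F (Pi.single a 1) (Pi.single b 1) (Pi.single c 1)

/-- Coordinates of `[⊗x_i, ⊗y_i] = ⊗(x_i ∧ y_i)` (and of `[⊗f_i, ⊗g_i] = ⊗(f_i ∧ g_i)`). -/
def wedgeT (x y : T3 F) : T3 F := fun c d e =>
  ∑ i, ∑ j, ∑ k, ∑ l, ∑ m, ∑ n,
    x i j k * y l m n * eps F i l c * eps F j m d * eps F k n e

/-- Coordinates of the action of `(g₁,g₂,g₃) ∈ sl(X₁)⊕sl(X₂)⊕sl(X₃)` on `X₁⊗X₂⊗X₃`. -/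
def actT (g : gl3 F × gl3 F × gl3 F) (x : T3 F) : T3 F := fun i j k =>
  (∑ a, g.1 i a * x a j k) + (∑ a, g.2.1 j a * x i a k) + (∑ a, g.2.2 k a * x i j a)

/-- Coordinates of the action of `(g₁,g₂,g₃)` on `X₁*⊗X₂*⊗X₃*` (minus the dual action). -/
def coactT (g : gl3 F × gl3 F × gl3 F) (f : T3 F) : T3 F := fun i j k =>
  -((∑ a, g.1 a i * f a j k) + (∑ a, g.2.1 a j * f i a k) + (∑ a, g.2.2 a k * f i j a))

/-- The full contraction `⟨f, x⟩ = Σ f_{ijk} x_{ijk}`. -/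
def tpair (f x : T3 F) : F := ∑ i, ∑ j, ∑ k, f i j k * x i j k

/-- The `sl(X₁)`-component of `[⊗f_i, ⊗x_i]`. -/
def pair1 (f x : T3 F) : gl3 F := Matrix.of fun r s =>
  (∑ j, ∑ k, f s j k * x r j k) - (1/3 : F) * (if r = s then tpair F f x else 0)

/-- The `sl(X₂)`-component of `[⊗f_i, ⊗x_i]`. -/
def pair2 (f x : T3 F) : gl3 F := Matrix.of fun r s =>
  (∑ i, ∑ k, f i s k * x i r k) - (1/3 : F) * (if r = s then tpair F f x else 0)

/-- The `sl(X₃)`-component of `[⊗f_i, ⊗x_i]`. -/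
def pair3 (f x : T3 F) : gl3 F := Matrix.of fun r s =>
  (∑ i, ∑ j, f i j s * x i j r) - (1/3 : F) * (if r = s then tpair F f x else 0)

/-- The bracket of the model of `e₆`, written out on the ambient coordinate space. -/
def B (u v : Mbig F) : Mbig F :=
  ( ( (u.1.1 * v.1.1 - v.1.1 * u.1.1) + pair1 F u.2.2 v.2.1 - pair1 F v.2.2 u.2.1,
      (u.1.2.1 * v.1.2.1 - v.1.2.1 * u.1.2.1) + pair2 F u.2.2 v.2.1 - pair2 F v.2.2 u.2.1,
      (u.1.2.2 * v.1.2.2 - v.1.2.2 * u.1.2.2) + pair3 F u.2.2 v.2.1 - pair3 F v.2.2 u.2.1 ),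
    ( actT F u.1 v.2.1 - actT F v.1 u.2.1 + wedgeT F u.2.2 v.2.2,
      coactT F u.1 v.2.2 - coactT F v.1 u.2.2 + wedgeT F u.2.1 v.2.1 ) )

lemma trace_pair1 (f x : T3 F) : Matrix.trace (pair1 F f x) = 0 := by
  simp only [pair1, Matrix.trace, Matrix.diag, Matrix.of_apply, if_pos, tpair,
    Finset.sum_sub_distrib, Finset.sum_const, Finset.card_univ, Fintype.card_fin,
    nsmul_eq_mul, Nat.cast_ofNat]
  ring

lemma trace_pair2 (f x : T3 F) : Matrix.trace (pair2 F f x) = 0 := by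
  simp only [pair2, Matrix.trace, Matrix.diag, Matrix.of_apply, if_pos, tpair,
    Finset.sum_sub_distrib, Finset.sum_const, Finset.card_univ, Fintype.card_fin,
    nsmul_eq_mul, Nat.cast_ofNat]
  rw [Finset.sum_comm]
  ring

lemma sum_rotate (h : Fin 3 → Fin 3 → Fin 3 → F) :
    ∑ r, ∑ i, ∑ j, h i j r = ∑ i, ∑ j, ∑ r, h i j r := by
  rw [Finset.sum_comm]
  exact Finset.sum_congr rfl fun i _ => Finset.sum_comm

lemma trace_pair3 (f x : T3 F) : Matrix.trace (pair3 F f x) = 0 := by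
  simp only [pair3, Matrix.trace, Matrix.diag, Matrix.of_apply, if_pos, tpair,
    Finset.sum_sub_distrib, Finset.sum_const, Finset.card_univ, Fintype.card_fin,
    nsmul_eq_mul, Nat.cast_ofNat]
  rw [sum_rotate F (fun i j r => f i j r * x i j r)]
  ring

/-- The bracket takes values in (the ambient copy of) `L`. -/
lemma B_mem (u v : Mbig F) : B F u v ∈ Lsub F := by
  refine ⟨⟨?_, ?_, ?_⟩, trivial, trivial⟩
  · show Matrix.trace ((u.1.1 * v.1.1 - v.1.1 * u.1.1)
        + pair1 F u.2.2 v.2.1 - pair1 F v.2.2 u.2.1) = 0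
    rw [Matrix.trace_sub, Matrix.trace_add, Matrix.trace_sub, trace_pair1, trace_pair1,
      Matrix.trace_mul_comm]
    ring
  · show Matrix.trace ((u.1.2.1 * v.1.2.1 - v.1.2.1 * u.1.2.1)
        + pair2 F u.2.2 v.2.1 - pair2 F v.2.2 u.2.1) = 0
    rw [Matrix.trace_sub, Matrix.trace_add, Matrix.trace_sub, trace_pair2, trace_pair2,
      Matrix.trace_mul_comm]
    ring
  · show Matrix.trace ((u.1.2.2 * v.1.2.2 - v.1.2.2 * u.1.2.2)
        + pair3 F u.2.2 v.2.1 - pair3 F v.2.2 u.2.1) = 0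
    rw [Matrix.trace_sub, Matrix.trace_add, Matrix.trace_sub, trace_pair3, trace_pair3,
      Matrix.trace_mul_comm]
    ring

/-- The bracket of the model of `e₆` on `L` itself. -/
def Bsub (u v : ↥(Lsub F)) : ↥(Lsub F) := ⟨B F ↑u ↑v, B_mem F ↑u ↑v⟩


/-- `φ₁`: the automorphism of the ℤ₃-grading `L = L₀ ⊕ L₁ ⊕ L₂`: identity on `L₀`,
multiplication by `ω` on `L₁` and by `ω²` on `L₂`. -/
def phi1 (ω : F) : Mbig F →ₗ[F] Mbig F where
  toFun u := (u.1, (ω • u.2.1, ω ^ 2 • u.2.2))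
  map_add' u v := by
    ext <;> simp [mul_add]
  map_smul' c u := by
    ext <;> simp [smul_eq_mul] <;> ring

/-- The cyclic shift matrix `P : e_a ↦ e_{a+1}`. -/
def Pcyc : gl3 F := !![0, 0, 1; 1, 0, 0; 0, 1, 0]

/-- `φ₂`: the automorphism extending `u_i⊗v_j⊗w_k ↦ u_{i+1}⊗v_{j+1}⊗w_{k+1}`, acting by
conjugation by the cyclic shift on each `sl(X_i)` and by the inverse-dual maps on `L₂`. -/
def phi2 : Mbig F →ₗ[F] Mbig F where
  toFun u := ((Pcyc F * u.1.1 * (Pcyc F)ᵀ, Pcyc F * u.1.2.1 * (Pcyc F)ᵀ,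
               Pcyc F * u.1.2.2 * (Pcyc F)ᵀ),
              ((fun i j k => u.2.1 (i - 1) (j - 1) (k - 1)),
               (fun i j k => u.2.2 (i - 1) (j - 1) (k - 1))))
  map_add' u v := by
    ext <;> simp [Matrix.mul_add, Matrix.add_mul]
  map_smul' c u := by
    ext <;> simp [Matrix.mul_smul, Matrix.smul_mul]

/-- `φ₃`: the automorphism extending `u_i⊗v_j⊗w_k ↦ ω^{i+j+k}·u_i⊗v_j⊗w_k`, acting by
conjugation by `diag(1,ω,ω²)` on each `sl(X_i)` and by the inverse-dual maps on `L₂`. -/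
def phi3 (ω : F) : Mbig F →ₗ[F] Mbig F where
  toFun u :=
    ((Matrix.diagonal ![1, ω, ω ^ 2] * u.1.1 * Matrix.diagonal ![1, ω ^ 2, ω],
      Matrix.diagonal ![1, ω, ω ^ 2] * u.1.2.1 * Matrix.diagonal ![1, ω ^ 2, ω],
      Matrix.diagonal ![1, ω, ω ^ 2] * u.1.2.2 * Matrix.diagonal ![1, ω ^ 2, ω]),
     ((fun i j k => ω ^ (i.val + j.val + k.val) * u.2.1 i j k),
      (fun i j k => ω ^ (2 * (i.val + j.val + k.val)) * u.2.2 i j k)))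
  map_add' u v := by
    ext <;> simp [Matrix.mul_add, Matrix.add_mul, mul_add] <;> ring
  map_smul' c u := by
    ext <;> simp [Matrix.mul_smul, Matrix.smul_mul, smul_eq_mul] <;> ring

/-- The `c`-eigenspace of an endomorphism of the ambient space. -/
def eigAmb (φ : Mbig F →ₗ[F] Mbig F) (c : F) : Submodule F (Mbig F) :=
  LinearMap.ker (φ - c • LinearMap.id)

/-- `ω^a` for `a : ℤ₃`. -/
def wpow (ω : F) (a : ZMod 3) : F := ω ^ a.val

/-- The homogeneous component `L_{(a,b,c)}` of the `ℤ₃³`-grading of the model of `e₆`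
determined by the commuting automorphisms `φ₁, φ₂, φ₃`. -/
def Lcomp (ω : F) (g : ZMod 3 × ZMod 3 × ZMod 3) : Submodule F ↥(Lsub F) :=
  Submodule.comap (Lsub F).subtype
    (eigAmb F (phi1 F ω) (wpow F ω g.1) ⊓ eigAmb F (phi2 F) (wpow F ω g.2.1) ⊓
      eigAmb F (phi3 F ω) (wpow F ω g.2.2))

/-- The subalgebra of elements of `L` fixed by both `φ₁` and `φ₂`. -/
def Fix12 (ω : F) : Submodule F ↥(Lsub F) :=
  Submodule.comap (Lsub F).subtype
    (LinearMap.ker (phi1 F ω - LinearMap.id) ⊓ LinearMap.ker (phi2 F - LinearMap.id))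

/-- The subalgebra of elements of `L` fixed by both `φ₁` and `φ₃`. -/
def Fix13 (ω : F) : Submodule F ↥(Lsub F) :=
  Submodule.comap (Lsub F).subtype
    (LinearMap.ker (phi1 F ω - LinearMap.id) ⊓ LinearMap.ker (phi3 F ω - LinearMap.id))

/-- Circulant trace-zero matrices. -/
def circMap : F × F →ₗ[F] gl3 F where
  toFun p := !![0, p.2, p.1; p.1, 0, p.2; p.2, p.1, 0]
  map_add' p q := by
    ext i j; fin_cases i <;> fin_cases j <;> simp
  map_smul' c p := by
    ext i j; fin_cases i <;> fin_cases j <;> simp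

/-- Diagonal trace-zero matrices. -/
def diagMap : F × F →ₗ[F] gl3 F where
  toFun p := !![p.1, 0, 0; 0, p.2, 0; 0, 0, -p.1 - p.2]
  map_add' p q := by
    ext i j; fin_cases i <;> fin_cases j <;> simp
    ring
  map_smul' c p := by
    ext i j; fin_cases i <;> fin_cases j <;> simp
    ring

lemma circ_iff (g : gl3 F) :
    (Pcyc F * g * (Pcyc F)ᵀ = g ∧ Matrix.trace g = 0) ↔ g ∈ LinearMap.range (circMap F) := by
  constructor
  · rintro ⟨h, ht⟩
    have e := fun i j => congrFun (congrFun h i) j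
    simp only [Fin.forall_fin_succ, Pcyc, Matrix.mul_apply, Fin.sum_univ_three] at e
    simp [Fin.forall_fin_succ] at e
    simp [Matrix.trace, Fin.sum_univ_three] at ht
    have h3 : (3 : F) ≠ 0 := by norm_num
    have h0 : g 0 0 = 0 := by
      apply mul_left_cancel₀ h3
      grind
    refine ⟨(g 1 0, g 2 0), ?_⟩
    ext i j; fin_cases i <;> fin_cases j <;> simp [circMap] <;> grind
  · rintro ⟨p, rfl⟩
    constructor
    · ext i j; fin_cases i <;> fin_cases j <;>
        simp [circMap, Pcyc, Matrix.mul_apply, Fin.sum_univ_three]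
    · simp [circMap, Matrix.trace, Fin.sum_univ_three]

lemma diag_iff (ω : F) (h1 : ω ≠ 1) (h3 : ω ^ 3 = 1) (g : gl3 F) :
    (Matrix.diagonal ![1, ω, ω ^ 2] * g * Matrix.diagonal ![1, ω ^ 2, ω] = g
      ∧ Matrix.trace g = 0) ↔ g ∈ LinearMap.range (diagMap F) := by
  have h2 : ω ^ 2 ≠ 1 := by
    intro h; apply h1; grind
  have c1 : ∀ x : F, ω * x = x → x = 0 := by
    intro x hx
    have : (ω - 1) * x = 0 := by linear_combination hx
    exact (mul_eq_zero.mp this).resolve_left (sub_ne_zero.mpr h1)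
  have c2 : ∀ x : F, ω ^ 2 * x = x → x = 0 := by
    intro x hx
    have : (ω ^ 2 - 1) * x = 0 := by linear_combination hx
    exact (mul_eq_zero.mp this).resolve_left (sub_ne_zero.mpr h2)
  constructor
  · rintro ⟨h, ht⟩
    have e := fun i j => congrFun (congrFun h i) j
    simp only [Matrix.mul_diagonal, Matrix.diagonal_mul] at e
    have e01 := e 0 1
    have e02 := e 0 2
    have e10 := e 1 0
    have e12 := e 1 2
    have e20 := e 2 0
    have e21 := e 2 1
    simp at e01 e02 e10 e12 e20 e21
    simp only [Matrix.trace, Matrix.diag, Fin.sum_univ_three] at ht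
    have z01 := c2 (g 0 1) (by linear_combination e01)
    have z02 := c1 (g 0 2) (by linear_combination e02)
    have z10 := c1 (g 1 0) (by linear_combination e10)
    have z12 := c2 (g 1 2) (by linear_combination e12)
    have z20 := c2 (g 2 0) (by linear_combination e20)
    have z21 := c1 (g 2 1) (by linear_combination e21 - ω * h3 * g 2 1)
    refine ⟨(g 0 0, g 1 1), ?_⟩
    ext i j; fin_cases i <;> fin_cases j <;> simp [diagMap, z01, z02, z10, z12, z20, z21]
    linear_combination -ht
  · rintro ⟨p, rfl⟩
    constructor
    · ext i j
      rw [Matrix.mul_diagonal, Matrix.diagonal_mul]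
      fin_cases i <;> fin_cases j <;> simp [diagMap]
      · linear_combination p.2 * h3
      · linear_combination (-p.1 - p.2) * h3
    · simp [diagMap, Matrix.trace, Fin.sum_univ_three]

lemma circ_inj : Function.Injective (circMap F) := by
  intro p q h
  have h1 := congrFun (congrFun h 1) 0
  have h2 := congrFun (congrFun h 2) 0
  simp [circMap] at h1 h2
  exact Prod.ext h1 h2

lemma diag_inj : Function.Injective (diagMap F) := by
  intro p q h
  have h1 := congrFun (congrFun h 0) 0
  have h2 := congrFun (congrFun h 1) 1
  simp [diagMap] at h1 h2
  exact Prod.ext h1 h2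

lemma circ_comm (p q : F × F) : circMap F p * circMap F q = circMap F q * circMap F p := by
  ext i j; fin_cases i <;> fin_cases j <;>
    simp [circMap, Matrix.mul_apply, Fin.sum_univ_three] <;> ring

lemma diag_comm (p q : F × F) : diagMap F p * diagMap F q = diagMap F q * diagMap F p := by
  ext i j; fin_cases i <;> fin_cases j <;>
    simp [diagMap, Matrix.mul_apply, Fin.sum_univ_three] <;> ring

/-- Embedding of three copies of a two-parameter family into the ambient space. -/
def bigMap (c : F × F →ₗ[F] gl3 F) : ((F × F) × (F × F) × (F × F)) →ₗ[F] Mbig F :=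
  LinearMap.prod (c.prodMap (c.prodMap c)) 0

lemma B_L0 (u v : Mbig F) (hu : u.2 = 0) (hv : v.2 = 0)
    (h1 : u.1.1 * v.1.1 = v.1.1 * u.1.1) (h2 : u.1.2.1 * v.1.2.1 = v.1.2.1 * u.1.2.1)
    (h3 : u.1.2.2 * v.1.2.2 = v.1.2.2 * u.1.2.2) : B F u v = 0 := by
  have p1 : pair1 F 0 0 = 0 := by ext; simp [pair1, tpair]
  have p2 : pair2 F 0 0 = 0 := by ext; simp [pair2, tpair]
  have p3 : pair3 F 0 0 = 0 := by ext; simp [pair3, tpair]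
  have w : wedgeT F 0 0 = 0 := by ext; simp [wedgeT]
  have a : ∀ g, actT F g 0 = 0 := by intro g; ext; simp [actT]
  have b : ∀ g, coactT F g 0 = 0 := by intro g; ext; simp [coactT]
  simp only [B, hu, hv, h1, h2, h3, Prod.fst_zero, Prod.snd_zero, p1, p2, p3, w, a, b, sub_self,
    add_zero]
  rfl

lemma generic (c : F × F →ₗ[F] gl3 F) (hc : Function.Injective c)
    (hcomm : ∀ p q, c p * c q = c q * c p) (W : Submodule F ↥(Lsub F))
    (hW : ∀ u : ↥(Lsub F), u ∈ W ↔ (u : Mbig F).2 = 0 ∧ (u : Mbig F).1.1 ∈ LinearMap.range c ∧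
      (u : Mbig F).1.2.1 ∈ LinearMap.range c ∧ (u : Mbig F).1.2.2 ∈ LinearMap.range c)
    (htr : ∀ p, Matrix.trace (c p) = 0) :
    (∀ u ∈ W, ∀ v ∈ W, Bsub F u v = 0) ∧ Module.finrank F ↥W = 6 := by
  constructor
  · intro u hu v hv
    obtain ⟨hu0, ⟨a1, ha1⟩, ⟨a2, ha2⟩, ⟨a3, ha3⟩⟩ := (hW u).1 hu
    obtain ⟨hv0, ⟨b1, hb1⟩, ⟨b2, hb2⟩, ⟨b3, hb3⟩⟩ := (hW v).1 hv
    apply Subtype.ext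
    refine B_L0 F _ _ hu0 hv0 ?_ ?_ ?_
    · rw [← ha1, ← hb1, hcomm]
    · rw [← ha2, ← hb2, hcomm]
    · rw [← ha3, ← hb3, hcomm]
  · have hmem : ∀ x, bigMap F c x ∈ Lsub F := by
      intro x
      exact ⟨⟨htr _, htr _, htr _⟩, trivial, trivial⟩
    let f := LinearMap.codRestrict (Lsub F) (bigMap F c) hmem
    have hf : Function.Injective f := by
      intro x y h
      have h' : bigMap F c x = bigMap F c y := congrArg Subtype.val h
      have h1 := congrArg Prod.fst h'
      exact Prod.ext (hc (congrArg Prod.fst h1))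
        (Prod.ext (hc (congrArg (fun z => z.2.1) h1)) (hc (congrArg (fun z => z.2.2) h1)))
    have hr : W = LinearMap.range f := by
      ext u
      rw [hW, LinearMap.mem_range]
      constructor
      · rintro ⟨h0, ⟨a1, h1⟩, ⟨a2, h2⟩, ⟨a3, h3⟩⟩
        refine ⟨(a1, a2, a3), Subtype.ext ?_⟩
        exact Prod.ext (Prod.ext h1 (Prod.ext h2 h3)) h0.symm
      · rintro ⟨x, rfl⟩
        exact ⟨rfl, ⟨_, rfl⟩, ⟨_, rfl⟩, ⟨_, rfl⟩⟩
    rw [hr, LinearMap.finrank_range_of_inj hf]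
    simp

lemma phi1_fix (ω : F) (h1 : ω ≠ 1) (h2 : ω ^ 2 ≠ 1) (u : Mbig F) :
    phi1 F ω u = u ↔ u.2 = 0 := by
  constructor
  · intro h
    have a : ω • u.2.1 = u.2.1 := congrArg (fun z => z.2.1) h
    have b : ω ^ 2 • u.2.2 = u.2.2 := congrArg (fun z => z.2.2) h
    have a' : (ω - 1) • u.2.1 = 0 := by rw [sub_smul, a, one_smul, sub_self]
    have b' : (ω ^ 2 - 1) • u.2.2 = 0 := by rw [sub_smul, b, one_smul, sub_self]
    exact Prod.ext ((smul_eq_zero.mp a').resolve_left (sub_ne_zero.mpr h1))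
      ((smul_eq_zero.mp b').resolve_left (sub_ne_zero.mpr h2))
  · intro h
    refine Prod.ext rfl ?_
    show (ω • u.2.1, ω ^ 2 • u.2.2) = u.2
    rw [h]; simp

lemma mem12 (ω : F) (h1 : ω ≠ 1) (h2 : ω ^ 2 ≠ 1) (u : ↥(Lsub F)) : u ∈ Fix12 F ω ↔
    (u : Mbig F).2 = 0 ∧ (u : Mbig F).1.1 ∈ LinearMap.range (circMap F) ∧
      (u : Mbig F).1.2.1 ∈ LinearMap.range (circMap F) ∧
      (u : Mbig F).1.2.2 ∈ LinearMap.range (circMap F) := by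
  obtain ⟨u, ⟨⟨t1, t2, t3⟩, -⟩⟩ := u
  simp only [Fix12, Submodule.mem_comap, Submodule.mem_inf, LinearMap.mem_ker,
    LinearMap.sub_apply, LinearMap.id_apply, sub_eq_zero, Submodule.subtype_apply,
    phi1_fix F ω h1 h2, ← circ_iff]
  refine and_congr_right fun h0 => ?_
  constructor
  · intro h
    exact ⟨⟨congrArg (fun z => z.1.1) h, t1⟩, ⟨congrArg (fun z => z.1.2.1) h, t2⟩,
      ⟨congrArg (fun z => z.1.2.2) h, t3⟩⟩
  · rintro ⟨⟨a, -⟩, ⟨b, -⟩, ⟨c, -⟩⟩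
    refine Prod.ext (Prod.ext a (Prod.ext b c)) ?_
    simp only [phi2, LinearMap.coe_mk, AddHom.coe_mk, h0]
    rfl

lemma mem13 (ω : F) (h1 : ω ≠ 1) (h2 : ω ^ 2 ≠ 1) (h3 : ω ^ 3 = 1) (u : ↥(Lsub F)) :
    u ∈ Fix13 F ω ↔
    (u : Mbig F).2 = 0 ∧ (u : Mbig F).1.1 ∈ LinearMap.range (diagMap F) ∧
      (u : Mbig F).1.2.1 ∈ LinearMap.range (diagMap F) ∧
      (u : Mbig F).1.2.2 ∈ LinearMap.range (diagMap F) := by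
  obtain ⟨u, ⟨⟨t1, t2, t3⟩, -⟩⟩ := u
  simp only [Fix13, Submodule.mem_comap, Submodule.mem_inf, LinearMap.mem_ker,
    LinearMap.sub_apply, LinearMap.id_apply, sub_eq_zero, Submodule.subtype_apply,
    phi1_fix F ω h1 h2, ← diag_iff F ω h1 h3]
  refine and_congr_right fun h0 => ?_
  constructor
  · intro h
    exact ⟨⟨congrArg (fun z => z.1.1) h, t1⟩, ⟨congrArg (fun z => z.1.2.1) h, t2⟩,
      ⟨congrArg (fun z => z.1.2.2) h, t3⟩⟩
  · rintro ⟨⟨a, -⟩, ⟨b, -⟩, ⟨c, -⟩⟩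
    refine Prod.ext (Prod.ext a (Prod.ext b c)) ?_
    simp only [phi3, LinearMap.coe_mk, AddHom.coe_mk, h0]
    simp
    constructor <;> rfl

lemma circ_diag (g : gl3 F) (h1 : g ∈ LinearMap.range (circMap F))
    (h2 : g ∈ LinearMap.range (diagMap F)) : g = 0 := by
  obtain ⟨p, rfl⟩ := h1
  obtain ⟨q, hq⟩ := h2
  have e1 := congrFun (congrFun hq 1) 0
  have e2 := congrFun (congrFun hq 2) 0
  simp [circMap, diagMap] at e1 e2
  have : p = 0 := Prod.ext e1.symm e2.symm
  rw [this, map_zero]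

/-- the subalgebra of `L` of elements fixed by `φ₁` and `φ₂` is an abelian
Lie subalgebra of dimension 6; so is the subalgebra of elements fixed by `φ₁` and `φ₃`;
and the two intersect in `0`. -/
theorem fixed_subalgebras_are_disjoint_cartans (ω : F) (hω : IsPrimitiveRoot ω 3) :
    ((∀ u ∈ Fix12 F ω, ∀ v ∈ Fix12 F ω, Bsub F u v = 0) ∧
      Module.finrank F ↥(Fix12 F ω) = 6) ∧
    ((∀ u ∈ Fix13 F ω, ∀ v ∈ Fix13 F ω, Bsub F u v = 0) ∧
      Module.finrank F ↥(Fix13 F ω) = 6) ∧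
    Fix12 F ω ⊓ Fix13 F ω = ⊥ := by
  have h1 : ω ≠ 1 := hω.ne_one (by norm_num)
  have h3 : ω ^ 3 = 1 := hω.pow_eq_one
  have h2 : ω ^ 2 ≠ 1 := hω.pow_ne_one_of_pos_of_lt (by norm_num) (by norm_num)
  refine ⟨generic F (circMap F) (circ_inj F) (circ_comm F) _ (mem12 F ω h1 h2)
      fun p => ((circ_iff F _).2 ⟨p, rfl⟩).2,
    generic F (diagMap F) (diag_inj F) (diag_comm F) _ (mem13 F ω h1 h2 h3)
      fun p => ((diag_iff F ω h1 h3 _).2 ⟨p, rfl⟩).2, ?_⟩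
  rw [eq_bot_iff]
  rintro u ⟨hu, hv⟩
  obtain ⟨h0, a1, a2, a3⟩ := (mem12 F ω h1 h2 u).1 hu
  obtain ⟨-, b1, b2, b3⟩ := (mem13 F ω h1 h2 h3 u).1 hv
  rw [Submodule.mem_bot]
  apply Subtype.ext
  exact Prod.ext (Prod.ext (circ_diag F _ a1 b1)
    (Prod.ext (circ_diag F _ a2 b2) (circ_diag F _ a3 b3))) h0

end
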